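/- For every ν ≥ 0 and every x > x*_ν, V_{φup_ν}(x) < 1 − (ν² − 1/4)/x² − (2ν² + x²)/(x² − ν²)². -/

import Mathlib

/-- The potential `V_f` associated with a function `f` via Liouville's transformation. -/
noncomputable def potential (f : ℝ → ℝ) (x : ℝ) : ℝ :=
  (deriv f x) ^ 2 + (1 / 2) * (deriv (deriv (deriv f)) x / deriv f x)
    - (3 / 4) * (deriv (deriv f) x / deriv f x) ^ 2

/-- The upper bound for the phase of Bessel derivatives:
`φup_ν(x) := √(x² − ν²) − ν·arccos(ν/x) + π/4 + (9x² − 2ν²)/(24(x² − ν²)^{3/2})`. -/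
noncomputable def phiUp (ν x : ℝ) : ℝ :=
  Real.sqrt (x ^ 2 - ν ^ 2) - ν * Real.arccos (ν / x) + Real.pi / 4
    + (9 * x ^ 2 - 2 * ν ^ 2) / (24 * Real.sqrt (x ^ 2 - ν ^ 2) ^ 3)

/-- The polynomial `p_ν(x) := 8x⁶ − 3(8ν² + 1)x⁴ + 4ν²(6ν² − 1)x² − 8ν⁶`. -/
noncomputable def pPoly (ν x : ℝ) : ℝ :=
  8 * x ^ 6 - 3 * (8 * ν ^ 2 + 1) * x ^ 4 + 4 * ν ^ 2 * (6 * ν ^ 2 - 1) * x ^ 2 - 8 * ν ^ 6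

lemma pPoly_eq_cube_sub (ν x : ℝ) :
    pPoly ν x = 8 * (x ^ 2 - ν ^ 2) ^ 3 - x ^ 2 * (3 * x ^ 2 + 4 * ν ^ 2) := by
  unfold pPoly; ring

lemma continuous_pPoly (ν : ℝ) : Continuous (pPoly ν) := by
  unfold pPoly; fun_prop

/-- Beyond its last root the polynomial `pPoly ν` is positive. -/
lemma pPoly_pos_of_unique_root {ν xstar x : ℝ} (hν : 0 ≤ ν) (hstar : ν < xstar)
    (huniq : ∀ y, ν < y → pPoly ν y = 0 → y = xstar) (hx : xstar < x) : 0 < pPoly ν x := by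
  by_contra! hneg
  set y := x + 2 * ν + 3 with hy
  have hyx : x ≤ y := by linarith
  have hy2 : 2 * ν ^ 2 + 6 < y ^ 2 := by nlinarith
  have hypos : 0 ≤ pPoly ν y := by
    rw [pPoly_eq_cube_sub]
    have hν2 := sq_nonneg ν
    have hcube : (y ^ 2 / 2) ^ 3 ≤ (y ^ 2 - ν ^ 2) ^ 3 := by gcongr; linarith
    have hprod : y ^ 2 * (3 * y ^ 2 + 4 * ν ^ 2) ≤ y ^ 2 * (y ^ 2 * y ^ 2) := by
      gcongr
      nlinarith
    nlinarith
  obtain ⟨z, hz, hz0⟩ := intermediate_value_Icc hyx (continuous_pPoly ν).continuousOn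
    (Set.mem_Icc.mpr ⟨hneg, hypos⟩)
  have := huniq z (by linarith [hz.1]) hz0
  linarith [hz.1]

lemma hasDerivAt_sqrt_sq_sub_sq {ν x : ℝ} (hd : 0 < x ^ 2 - ν ^ 2) :
    HasDerivAt (fun y => √(y ^ 2 - ν ^ 2)) (x / √(x ^ 2 - ν ^ 2)) x := by
  have h := ((hasDerivAt_pow 2 x).sub_const (ν ^ 2)).sqrt hd.ne'
  refine h.congr_deriv ?_
  push_cast
  field_simp

/-- The derivative of a quotient of the form `N(x) / (8 x^j √(x² - ν²)^k)`. -/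
lemma hasDerivAt_div_pow_mul_sqrt_pow {ν x N' : ℝ} {N : ℝ → ℝ} (j k : ℕ) (hx : x ≠ 0)
    (hd : 0 < x ^ 2 - ν ^ 2) (hN : HasDerivAt N N' x) :
    HasDerivAt (fun y => N y / (8 * y ^ (j + 1) * √(y ^ 2 - ν ^ 2) ^ (k + 1)))
      ((N' * x * (x ^ 2 - ν ^ 2) - (j + 1) * N x * (x ^ 2 - ν ^ 2) - (k + 1) * x ^ 2 * N x)
        / (8 * x ^ (j + 2) * √(x ^ 2 - ν ^ 2) ^ (k + 3))) x := by
  have hs : 0 < √(x ^ 2 - ν ^ 2) := Real.sqrt_pos.mpr hd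
  have hsq : √(x ^ 2 - ν ^ 2) ^ 2 = x ^ 2 - ν ^ 2 := Real.sq_sqrt hd.le
  have hden := ((hasDerivAt_pow (j + 1) x).const_mul 8).fun_mul
    ((hasDerivAt_sqrt_sq_sub_sq hd).fun_pow (k + 1))
  have h := hN.fun_div hden (by positivity)
  refine h.congr_deriv ?_
  simp only [Nat.add_sub_cancel, Nat.cast_add, Nat.cast_one]
  rw [← hsq, Real.sqrt_sq hs.le]
  set s := √(x ^ 2 - ν ^ 2)
  field_simp
  ring

lemma hasDerivAt_phiUp {ν x : ℝ} (hν : 0 ≤ ν) (hx : ν < x) :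
    HasDerivAt (phiUp ν)
      (pPoly ν x / (8 * x ^ (0 + 1) * √(x ^ 2 - ν ^ 2) ^ (4 + 1))) x := by
  have hx0 : 0 < x := hν.trans_lt hx
  have hd : 0 < x ^ 2 - ν ^ 2 := by nlinarith
  have hs : 0 < √(x ^ 2 - ν ^ 2) := Real.sqrt_pos.mpr hd
  have hsq : √(x ^ 2 - ν ^ 2) ^ 2 = x ^ 2 - ν ^ 2 := Real.sq_sqrt hd.le
  have hsqrt := hasDerivAt_sqrt_sq_sub_sq hd
  have hu1 : ν / x < 1 := (div_lt_one hx0).mpr hx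
  have hu0 : 0 ≤ ν / x := by positivity
  have hroot : √(1 - (ν / x) ^ 2) = √(x ^ 2 - ν ^ 2) / x := by
    rw [show 1 - (ν / x) ^ 2 = (x ^ 2 - ν ^ 2) / x ^ 2 by field_simp,
      Real.sqrt_div hd.le, Real.sqrt_sq hx0.le]
  have hdiv : HasDerivAt (fun y => ν / y) (-ν / x ^ 2) x := by
    simpa using (hasDerivAt_const x ν).fun_div (hasDerivAt_id x) hx0.ne'
  have harccos := (Real.hasDerivAt_arccos (by linarith) hu1.ne).comp x hdiv
  have hnum : HasDerivAt (fun y : ℝ => 9 * y ^ 2 - 2 * ν ^ 2) (18 * x) x := by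
    refine (((hasDerivAt_pow 2 x).const_mul 9).sub_const (2 * ν ^ 2)).congr_deriv ?_
    push_cast
    ring
  have hquot := hnum.fun_div ((hsqrt.fun_pow 3).const_mul 24) (by positivity)
  have h := ((hsqrt.sub (harccos.const_mul ν)).add_const (Real.pi / 4)).add hquot
  refine h.congr_deriv ?_
  simp only [hroot]
  have hν2 : ν ^ 2 = x ^ 2 - √(x ^ 2 - ν ^ 2) ^ 2 := by rw [hsq]; ring
  rw [pPoly_eq_cube_sub, ← hsq, Real.sqrt_sq hs.le]
  set s := √(x ^ 2 - ν ^ 2)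
  field_simp
  rw [hν2]
  ring

/-- The derivative of `pPoly ν` with respect to the square of its variable. -/
noncomputable def pPolyDerivSq (ν x : ℝ) : ℝ :=
  24 * (x ^ 2 - ν ^ 2) ^ 2 - 6 * x ^ 2 - 4 * ν ^ 2

lemma hasDerivAt_pPoly (ν x : ℝ) : HasDerivAt (pPoly ν) (2 * x * pPolyDerivSq ν x) x := by
  have h := ((((hasDerivAt_pow 6 x).const_mul 8).sub
    ((hasDerivAt_pow 4 x).const_mul (3 * (8 * ν ^ 2 + 1)))).add
    ((hasDerivAt_pow 2 x).const_mul (4 * ν ^ 2 * (6 * ν ^ 2 - 1)))).sub_const (8 * ν ^ 6)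
  refine h.congr_deriv ?_
  unfold pPolyDerivSq
  push_cast
  ring

lemma hasDerivAt_pPolyDerivSq (ν x : ℝ) :
    HasDerivAt (pPolyDerivSq ν) (2 * x * (48 * (x ^ 2 - ν ^ 2) - 6)) x := by
  have hsq := hasDerivAt_pow 2 x
  have h := ((((hsq.sub_const (ν ^ 2)).fun_pow 2).const_mul 24).sub
    (hsq.const_mul 6)).sub_const (4 * ν ^ 2)
  refine h.congr_deriv ?_
  push_cast
  ring

/-- The numerator of the second derivative of `phiUp ν`. -/
noncomputable def phiUpSecondNum (ν x : ℝ) : ℝ :=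
  2 * x ^ 2 * pPolyDerivSq ν x * (x ^ 2 - ν ^ 2) - pPoly ν x * (x ^ 2 - ν ^ 2)
    - 5 * x ^ 2 * pPoly ν x

/-- The derivative of `phiUpSecondNum ν` divided by its variable. -/
noncomputable def phiUpSecondNumDeriv (ν x : ℝ) : ℝ :=
  (2 * pPolyDerivSq ν x + 4 * x ^ 2 * (48 * (x ^ 2 - ν ^ 2) - 6)) * (x ^ 2 - ν ^ 2)
    - 6 * x ^ 2 * pPolyDerivSq ν x - 12 * pPoly ν x

/-- The numerator of the third derivative of `phiUp ν`. -/
noncomputable def phiUpThirdNum (ν x : ℝ) : ℝ :=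
  x ^ 2 * phiUpSecondNumDeriv ν x * (x ^ 2 - ν ^ 2) - 2 * phiUpSecondNum ν x * (x ^ 2 - ν ^ 2)
    - 7 * x ^ 2 * phiUpSecondNum ν x

lemma hasDerivAt_phiUpSecondNum (ν x : ℝ) :
    HasDerivAt (phiUpSecondNum ν) (x * phiUpSecondNumDeriv ν x) x := by
  have hsq := hasDerivAt_pow 2 x
  have hd := hsq.sub_const (ν ^ 2)
  have hP := hasDerivAt_pPoly ν x
  have h := ((((hsq.const_mul 2).fun_mul (hasDerivAt_pPolyDerivSq ν x)).fun_mul hd).sub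
    (hP.fun_mul hd)).sub ((hsq.const_mul 5).fun_mul hP)
  refine h.congr_deriv ?_
  unfold phiUpSecondNumDeriv
  push_cast
  ring

lemma deriv_phiUp {ν x : ℝ} (hν : 0 ≤ ν) (hx : ν < x) :
    deriv (phiUp ν) x = pPoly ν x / (8 * x ^ (0 + 1) * √(x ^ 2 - ν ^ 2) ^ (4 + 1)) :=
  (hasDerivAt_phiUp hν hx).deriv

lemma deriv_deriv_phiUp {ν x : ℝ} (hν : 0 ≤ ν) (hx : ν < x) :
    deriv (deriv (phiUp ν)) x
      = phiUpSecondNum ν x / (8 * x ^ (1 + 1) * √(x ^ 2 - ν ^ 2) ^ (6 + 1)) := by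
  have hev : deriv (phiUp ν) =ᶠ[nhds x] _ :=
    Filter.eventually_of_mem (Ioi_mem_nhds hx) fun y hy => deriv_phiUp hν hy
  rw [hev.deriv_eq, (hasDerivAt_div_pow_mul_sqrt_pow 0 4 (hν.trans_lt hx).ne' (by nlinarith)
    (hasDerivAt_pPoly ν x)).deriv]
  congr 1
  unfold phiUpSecondNum
  push_cast
  ring

lemma deriv_deriv_deriv_phiUp {ν x : ℝ} (hν : 0 ≤ ν) (hx : ν < x) :
    deriv (deriv (deriv (phiUp ν))) x
      = phiUpThirdNum ν x / (8 * x ^ 3 * √(x ^ 2 - ν ^ 2) ^ 9) := by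
  have hev : deriv (deriv (phiUp ν)) =ᶠ[nhds x] _ :=
    Filter.eventually_of_mem (Ioi_mem_nhds hx) fun y hy => deriv_deriv_phiUp hν hy
  rw [hev.deriv_eq, (hasDerivAt_div_pow_mul_sqrt_pow 1 6 (hν.trans_lt hx).ne' (by nlinarith)
    (hasDerivAt_phiUpSecondNum ν x)).deriv]
  congr 1
  unfold phiUpThirdNum
  push_cast
  ring

/-- The potential of `phiUp ν` as a rational function of `x ^ 2` and `ν ^ 2`. -/
lemma potential_phiUp {ν x : ℝ} (hν : 0 ≤ ν) (hx : ν < x) (hP : 0 < pPoly ν x) :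
    potential (phiUp ν) x
      = pPoly ν x ^ 2 / (64 * x ^ 2 * (x ^ 2 - ν ^ 2) ^ 5)
        + (2 * pPolyDerivSq ν x + 2 * x ^ 2 * (48 * (x ^ 2 - ν ^ 2) - 6)) / pPoly ν x
        + 5 * x ^ 2 * pPolyDerivSq ν x / (pPoly ν x * (x ^ 2 - ν ^ 2))
        - 3 * x ^ 2 * pPolyDerivSq ν x ^ 2 / pPoly ν x ^ 2
        + 1 / (4 * x ^ 2) - 5 / (x ^ 2 - ν ^ 2) - 5 * x ^ 2 / (4 * (x ^ 2 - ν ^ 2) ^ 2) := by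
  have hx0 : 0 < x := hν.trans_lt hx
  have hd : 0 < x ^ 2 - ν ^ 2 := by nlinarith
  have hs : 0 < √(x ^ 2 - ν ^ 2) := Real.sqrt_pos.mpr hd
  have hsq : √(x ^ 2 - ν ^ 2) ^ 2 = x ^ 2 - ν ^ 2 := Real.sq_sqrt hd.le
  unfold potential
  rw [deriv_phiUp hν hx, deriv_deriv_phiUp hν hx, deriv_deriv_deriv_phiUp hν hx]
  unfold phiUpThirdNum phiUpSecondNumDeriv phiUpSecondNum
  rw [← hsq, Real.sqrt_sq hs.le]
  generalize √(x ^ 2 - ν ^ 2) = s at hs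
  generalize pPoly ν x = P at hP
  generalize pPolyDerivSq ν x = Q
  field_simp
  ring

/-- The numerator of the difference of the two potentials, at `d = x² - ν²`, `n = ν²`, `t = n + d`,
is positive as soon as `pPoly ν x` is positive. -/
lemma potential_gap_numerator_pos {n d : ℝ} (hn : 0 ≤ n) (hd : 0 < d)
    (hP : 0 < 8 * d ^ 3 - (n + d) * (7 * n + 3 * d)) :
    0 < 384 * d ^ 4 * (8 * d ^ 3 - (n + d) * (7 * n + 3 * d)) ^ 2
      - (n + d) * (7 * n + 3 * d) ^ 2 * (8 * d ^ 3 - (n + d) * (7 * n + 3 * d)) ^ 2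
      - 128 * d ^ 5 * (24 * d ^ 2 - 10 * n - 6 * d + (n + d) * (48 * d - 6))
        * (8 * d ^ 3 - (n + d) * (7 * n + 3 * d))
      - 320 * (n + d) * d ^ 4 * (24 * d ^ 2 - 10 * n - 6 * d)
        * (8 * d ^ 3 - (n + d) * (7 * n + 3 * d))
      + 192 * (n + d) * d ^ 5 * (24 * d ^ 2 - 10 * n - 6 * d) ^ 2 := by
  obtain ⟨m, hm, rfl⟩ : ∃ m, 0 ≤ m ∧ n = m * d := ⟨n / d, by positivity, by field_simp⟩
  obtain ⟨w, hw⟩ : ∃ w, w = 8 * d - (1 + m) * (3 + 7 * m) := ⟨_, rfl⟩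
  have hPw : 8 * d ^ 3 - (m * d + d) * (7 * (m * d) + 3 * d) = d ^ 2 * w := by rw [hw]; ring
  have hw0 : 0 < w := by
    rw [hPw] at hP
    exact pos_of_mul_pos_right hP (by positivity)
  have hdw : d = ((1 + m) * (3 + 7 * m) + w) / 8 := by rw [hw]; ring
  rw [hPw]
  have hgap : 384 * d * w ^ 2 - (1 + m) * (3 + 7 * m) ^ 2 * w ^ 2
      - 128 * (24 * d - (10 * m + 6) + (1 + m) * (48 * d - 6)) * d * w
      - 320 * (1 + m) * d * (24 * d - (10 * m + 6)) * w
      + 192 * (1 + m) * d * (24 * d - (10 * m + 6)) ^ 2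
      = (648 + 11448 * m + 78984 * m ^ 2 + 275064 * m ^ 3 + 528600 * m ^ 4
          + 568680 * m ^ 5 + 321048 * m ^ 6 + 74088 * m ^ 7)
        + (432 + 6576 * m + 32096 * m ^ 2 + 66720 * m ^ 3 + 61936 * m ^ 4 + 21168 * m ^ 5) * w
        + (63 + 869 * m + 2205 * m ^ 2 + 1463 * m ^ 3) * w ^ 2 := by
    rw [hdw]; ring
  have hpos := hgap.ge.trans_lt' (by positivity)
  refine (mul_pos (pow_pos hd 7) hpos).trans_eq ?_
  ring

/-- On `(x*_ν, ∞)`, where `x*_ν` is the unique root of `p_ν` in `(ν, ∞)`, the potential of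
`φup_ν` is strictly below the potential of the Bessel derivative phase:
`V_{φup_ν}(x) < 1 − (ν² − 1/4)/x² − (2ν² + x²)/(x² − ν²)²`. -/
theorem phiUp_potential_lt_bessel_derivative_potential (ν : ℝ) (hν : 0 ≤ ν) (xstar : ℝ)
    (hxstar : ν < xstar ∧ pPoly ν xstar = 0 ∧ ∀ y, ν < y → pPoly ν y = 0 → y = xstar) :
    ∀ x, xstar < x →
      potential (phiUp ν) x
        < 1 - (ν ^ 2 - 1 / 4) / x ^ 2 - (2 * ν ^ 2 + x ^ 2) / (x ^ 2 - ν ^ 2) ^ 2 := by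
  intro x hx
  obtain ⟨hstar, -, huniq⟩ := hxstar
  have hνx : ν < x := hstar.trans hx
  have hP := pPoly_pos_of_unique_root hν hstar huniq hx
  have hd : 0 < x ^ 2 - ν ^ 2 := by nlinarith
  rw [potential_phiUp hν hνx hP, ← sub_pos]
  unfold pPolyDerivSq
  rw [pPoly_eq_cube_sub] at hP ⊢
  obtain ⟨n, hn⟩ : ∃ n, n = ν ^ 2 := ⟨_, rfl⟩
  obtain ⟨d, hdef⟩ : ∃ d, d = x ^ 2 - ν ^ 2 := ⟨_, rfl⟩
  have hxt : x ^ 2 = n + d := by rw [hn, hdef]; ring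
  have hn0 : 0 ≤ n := hn ▸ sq_nonneg ν
  rw [← hdef, ← hn, hxt] at hP ⊢
  rw [← hdef] at hd
  have hfac : 8 * d ^ 3 - (n + d) * (3 * (n + d) + 4 * n)
      = 8 * d ^ 3 - (n + d) * (7 * n + 3 * d) := by ring
  rw [hfac] at hP ⊢
  have hgap := potential_gap_numerator_pos hn0 hd hP
  refine (div_pos hgap (show 0 < 64 * d ^ 5 * (8 * d ^ 3 - (n + d) * (7 * n + 3 * d)) ^ 2 by
    positivity)).trans_eq ?_
  have hQ : 24 * d ^ 2 - 6 * (n + d) - 4 * n = 24 * d ^ 2 - 10 * n - 6 * d := by ring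
  rw [hQ]
  generalize 24 * d ^ 2 - 10 * n - 6 * d = Q
  have hsplit : (8 * d ^ 3 - (n + d) * (7 * n + 3 * d)) ^ 2 / (64 * (n + d) * d ^ 5)
      = (64 * d ^ 6 - 16 * d ^ 3 * (n + d) * (7 * n + 3 * d)
        + ((n + d) * (7 * n + 3 * d)) ^ 2) / (64 * (n + d) * d ^ 5) := by ring
  rw [hsplit]
  generalize 8 * d ^ 3 - (n + d) * (7 * n + 3 * d) = P at hP
  field_simp
  ring
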